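/- For every integer m ≥ 2, the Cartesian product K_m □ P_2 of a complete graph and a path on two vertices satisfies tndi(K_m □ P_2) = m + 2 = Δ + 2, where Δ = m is its maximum degree. -/

import Mathlib

open Finset SimpleGraph

/-- A neighbor-sum-distinguishing proper total `k`-coloring of `G`:
vertex colors `cv` and edge colors `ce` taken from `{1, …, k}`, proper on
vertices, edges, and incidences, and distinguishing adjacent vertices by the
total sum of colors at each vertex. -/
def IsProperTotalColoring {V : Type*} [Fintype V] (G : SimpleGraph V) (k : ℕ)
    (cv : V → ℕ) (ce : Sym2 V → ℕ) : Prop :=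
  (∀ v, cv v ∈ Finset.Icc 1 k) ∧
  (∀ u v, G.Adj u v → ce s(u, v) ∈ Finset.Icc 1 k) ∧
  (∀ u v, G.Adj u v → cv u ≠ cv v) ∧
  (∀ u v w, G.Adj u v → G.Adj u w → v ≠ w → ce s(u, v) ≠ ce s(u, w)) ∧
  (∀ u v, G.Adj u v → ce s(u, v) ≠ cv u ∧ ce s(u, v) ≠ cv v)

open Classical in
/-- The total color-sum at a vertex: the color of `v` plus the colors of all
edges incident with `v`. -/
noncomputable def totalSum {V : Type*} [Fintype V] (G : SimpleGraph V)
    (cv : V → ℕ) (ce : Sym2 V → ℕ) (v : V) : ℕ :=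
  cv v + ∑ w ∈ Finset.univ.filter (fun w => G.Adj v w), ce s(v, w)

/-- A neighbor-sum-distinguishing proper total `k`-coloring. -/
def IsNSDColoring {V : Type*} [Fintype V] (G : SimpleGraph V) (k : ℕ)
    (cv : V → ℕ) (ce : Sym2 V → ℕ) : Prop :=
  IsProperTotalColoring G k cv ce ∧
  ∀ u v, G.Adj u v → totalSum G cv ce u ≠ totalSum G cv ce v

/-- `tndi G` is the least `k` such that `G` admits a neighbor-sum-distinguishing
proper total `k`-coloring. -/
noncomputable def tndi {V : Type*} [Fintype V] (G : SimpleGraph V) : ℕ :=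
  sInf {k | ∃ cv ce, IsNSDColoring G k cv ce}

/-- The maximum degree of a finite simple graph. -/
noncomputable def maxDeg {V : Type*} [Fintype V] (G : SimpleGraph V) : ℕ :=
  @SimpleGraph.maxDegree V G _ (Classical.decRel _)

/-- The star `S_n = K_{1,n}` with center `0` and `n` leaves. -/
def starGraph (n : ℕ) : SimpleGraph (Fin (n + 1)) :=
  SimpleGraph.fromRel fun i _ => i = 0

/-- The wheel `W_m`: hub `0` joined to every vertex of the cycle on `1, …, m`. -/
def wheelGraph (m : ℕ) : SimpleGraph (Fin (m + 1)) :=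
  SimpleGraph.fromRel fun i j =>
    i = 0 ∨ (j.val = i.val + 1 ∧ 2 ≤ j.val) ∨ (i.val = m ∧ j.val = 1)

theorem adj_complete_boxProd_pathGraph_two {m : ℕ} (v w : Fin m × Fin 2) :
    ((⊤ : SimpleGraph (Fin m)).boxProd (pathGraph 2)).Adj v w ↔
      (v.1 ≠ w.1 ∧ v.2 = w.2) ∨ (v.1 = w.1 ∧ v.2 ≠ w.2) := by
  have h : ∀ a b : Fin 2, (pathGraph 2).Adj a b ↔ a ≠ b := by
    simp [pathGraph_two_eq_top]
  rw [boxProd_adj, h, top_adj]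
  tauto

/-- Projecting to the complete factor is a bijection from the neighbors of a vertex of
`K_m □ P_2` onto `Fin m`. -/
theorem sum_neighbors_complete_boxProd_pathGraph_two {m : ℕ} (v : Fin m × Fin 2)
    [DecidablePred (((⊤ : SimpleGraph (Fin m)).boxProd (pathGraph 2)).Adj v)] (f : Fin m → ℕ) :
    ∑ w ∈ univ.filter (((⊤ : SimpleGraph (Fin m)).boxProd (pathGraph 2)).Adj v), f w.1 =
      ∑ j, f j := by
  refine sum_nbij Prod.fst (fun _ _ => mem_univ _) ?_ ?_ (fun _ _ => rfl)
  · rintro ⟨a, b⟩ h ⟨c, d⟩ h' hac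
    simp only [coe_filter, mem_univ, true_and, Set.mem_ofPred_eq,
      adj_complete_boxProd_pathGraph_two] at h h' hac
    grind
  · intro j _
    simp only [coe_filter, mem_univ, true_and, Set.mem_image, Set.mem_ofPred_eq,
      adj_complete_boxProd_pathGraph_two]
    by_cases hj : v.1 = j
    · exact ⟨(j, v.2 + 1), Or.inr ⟨hj, by grind⟩, rfl⟩
    · exact ⟨(j, v.2), Or.inl ⟨hj, rfl⟩, rfl⟩

theorem card_neighbors_complete_boxProd_pathGraph_two {m : ℕ} (v : Fin m × Fin 2)
    [DecidablePred (((⊤ : SimpleGraph (Fin m)).boxProd (pathGraph 2)).Adj v)] :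
    (univ.filter (((⊤ : SimpleGraph (Fin m)).boxProd (pathGraph 2)).Adj v)).card = m := by
  simpa using sum_neighbors_complete_boxProd_pathGraph_two v fun _ => 1

theorem maxDeg_complete_boxProd_pathGraph_two {m : ℕ} (hm : 0 < m) :
    maxDeg ((⊤ : SimpleGraph (Fin m)).boxProd (pathGraph 2)) = m := by
  classical
  have : Nonempty (Fin m × Fin 2) := ⟨(⟨0, hm⟩, 0)⟩
  refine IsRegularOfDegree.maxDegree_eq (G := _) fun v => ?_
  rw [← card_neighborFinset_eq_degree, neighborFinset_eq_filter]
  exact card_neighbors_complete_boxProd_pathGraph_two v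

open Classical in
/-- The colors at a vertex of degree `d` are `d + 1` distinct elements of `{1, …, k}`; if
`k ≤ d + 1`, they are all of `{1, …, d + 1}`, which determines the color sum. -/
theorem IsProperTotalColoring.totalSum_eq {V : Type*} [Fintype V] {G : SimpleGraph V} {k d : ℕ}
    {cv : V → ℕ} {ce : Sym2 V → ℕ} (h : IsProperTotalColoring G k cv ce) (hk : k ≤ d + 1)
    (v : V) (hd : (univ.filter (G.Adj v)).card = d) :
    totalSum G cv ce v = ∑ c ∈ Icc 1 (d + 1), c := by
  obtain ⟨hcv, hce, -, hedge, hinc⟩ := h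
  have hinj : Set.InjOn (fun w => ce s(v, w)) (univ.filter (G.Adj v) : Finset V) := by
    intro x hx y hy hxy
    by_contra hne
    exact hedge v x y (by simpa using hx) (by simpa using hy) hne hxy
  have hnot : cv v ∉ (univ.filter (G.Adj v)).image fun w => ce s(v, w) := by
    simp only [mem_image, mem_filter, mem_univ, true_and, not_exists, not_and]
    exact fun w hw => (hinc v w hw).1
  have hsub : insert (cv v) ((univ.filter (G.Adj v)).image fun w => ce s(v, w)) ⊆
      Icc 1 (d + 1) := by
    refine Subset.trans ?_ (Icc_subset_Icc_right hk)
    refine insert_subset (hcv v) (image_subset_iff.2 fun w hw => hce v w ?_)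
    simpa using hw
  have heq := eq_of_subset_of_card_le hsub (by
    rw [card_insert_of_notMem hnot, card_image_of_injOn hinj, hd, Nat.card_Icc]; omega)
  rw [← heq, sum_insert hnot, sum_image hinj]
  rfl

theorem sum_range_add_eq_of_periodic {f : ℕ → ℕ} {n : ℕ} (hf : Function.Periodic f n) (i : ℕ) :
    ∑ j ∈ range n, f (i + j) = ∑ j ∈ range n, f j := by
  induction i with
  | zero => simp
  | succ i ih =>
    have h := (sum_range_succ (fun j => f (i + j)) n).symm.trans
      (sum_range_succ' (fun j => f (i + j)) n)
    simp only [hf i, add_zero, Nat.add_right_cancel_iff] at h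
    rw [← ih, h]
    exact sum_congr rfl fun j _ => congrArg f (by omega)

theorem add_mod_left_inj_of_lt {n i j k : ℕ} (hj : j < n) (hk : k < n)
    (h : (i + j) % n = (i + k) % n) : j = k :=
  (Nat.ModEq.add_left_cancel' i h).eq_of_lt_of_lt hj hk

/-- With colors read modulo `m + 2`, the edge joining the columns `i` and `j` receives `i + j`
and the vertex `(i, a)` receives `i + (m + a)`. The only color absent at `(i, a)` is then
`i + (m + 1 - a)`. -/
theorem exists_isNSDColoring_complete_boxProd_pathGraph_two (m : ℕ) :
    ∃ cv ce, IsNSDColoring ((⊤ : SimpleGraph (Fin m)).boxProd (pathGraph 2)) (m + 2) cv ce := by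
  let c : ℕ → ℕ := fun x => x % (m + 2) + 1
  have hc : ∀ x, c x ∈ Icc 1 (m + 2) := fun x =>
    mem_Icc.2 ⟨by simp [c], Nat.mod_lt x (by omega)⟩
  have hper : Function.Periodic c (m + 2) := fun x => by simp [c]
  have hinj : ∀ i j k, j < m + 2 → k < m + 2 → c (i + j) = c (i + k) → j = k :=
    fun i j k hj hk h => add_mod_left_inj_of_lt hj hk (Nat.succ_injective h)
  let cv : Fin m × Fin 2 → ℕ := fun v => c (v.1 + (m + v.2))
  let ce : Sym2 (Fin m × Fin 2) → ℕ :=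
    Sym2.lift ⟨fun v w => c (v.1 + w.1), fun v w => congrArg c (add_comm _ _)⟩
  have hce : ∀ v w, ce s(v, w) = c (v.1 + w.1) := fun _ _ => rfl
  have hsum : ∀ v, totalSum ((⊤ : SimpleGraph (Fin m)).boxProd (pathGraph 2)) cv ce v +
      c (v.1 + (m + (1 - v.2))) = ∑ j ∈ range (m + 2), c j := by
    intro v
    classical
    have hn := sum_neighbors_complete_boxProd_pathGraph_two v fun j => c (v.1 + j)
    rw [Fin.sum_univ_eq_sum_range fun j => c (v.1 + j)] at hn
    rw [← sum_range_add_eq_of_periodic hper v.1, sum_range_succ, sum_range_succ, ← hn]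
    obtain ⟨i, a⟩ := v
    simp only [totalSum, hce, cv]
    fin_cases a <;> simp <;> ring_nf
  have hproper : ∀ (v w : Fin m × Fin 2) (x y : ℕ), x < 2 → y < 2 →
      ((v.1 ≠ w.1 ∧ x = y) ∨ (v.1 = w.1 ∧ x ≠ y)) →
      c (v.1 + (m + x)) ≠ c (w.1 + (m + y)) := by
    rintro v w x y hx hy (⟨hne, rfl⟩ | ⟨heq, hne⟩) h
    · rw [add_comm, add_comm (w.1 : ℕ)] at h
      exact hne (Fin.ext (hinj _ _ _ (by omega) (by omega) h))
    · rw [heq] at h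
      exact hne (by have := hinj _ _ _ (by omega) (by omega) h; omega)
  have hinc : ∀ v w : Fin m × Fin 2, c (v.1 + w.1) ≠ cv v := fun v w h => by
    have := hinj _ _ _ (by omega) (by omega) h
    omega
  refine ⟨cv, ce, ⟨fun v => hc _, fun u v _ => hc _, fun u v h => ?_, fun u v w huv huw hne h => ?_,
    fun u v _ => ⟨hinc u v, ?_⟩⟩, fun u v h heq => ?_⟩
  · rw [adj_complete_boxProd_pathGraph_two] at h
    exact hproper u v _ _ u.2.2 v.2.2 (by simpa [Fin.ext_iff] using h)
  · rw [adj_complete_boxProd_pathGraph_two] at huv huw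
    have hvw : v.1 = w.1 := Fin.ext (hinj _ _ _ (by omega) (by omega) h)
    exact hne (Prod.ext hvw (by grind))
  · rw [hce, add_comm]
    exact hinc v u
  · rw [adj_complete_boxProd_pathGraph_two] at h
    refine hproper u v (1 - u.2) (1 - v.2) (by omega) (by omega) ?_ (by
      have hu := hsum u
      have hv := hsum v
      omega)
    simp only [Fin.ext_iff] at h ⊢
    omega

theorem stmt_18 (m : ℕ) (hm : 2 ≤ m) :
    maxDeg ((⊤ : SimpleGraph (Fin m)).boxProd (pathGraph 2)) = m ∧
    tndi ((⊤ : SimpleGraph (Fin m)).boxProd (pathGraph 2)) = m + 2 := by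
  refine ⟨maxDeg_complete_boxProd_pathGraph_two (by omega), le_antisymm
    (Nat.sInf_le (exists_isNSDColoring_complete_boxProd_pathGraph_two m))
    (le_csInf ⟨_, exists_isNSDColoring_complete_boxProd_pathGraph_two m⟩ ?_)⟩
  rintro k ⟨cv, ce, hproper, hsum⟩
  classical
  by_contra! hk
  refine hsum (⟨0, by omega⟩, 0) (⟨0, by omega⟩, 1) ?_ ?_
  · rw [adj_complete_boxProd_pathGraph_two]
    simp
  · have h := fun v => hproper.totalSum_eq (by omega) v
      (card_neighbors_complete_boxProd_pathGraph_two v)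
    rw [h, h]
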